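/- arXiv:1510.08149 — 5 statements merged into one kernel-verified Lean document; each statement's English description precedes it below -/
import Mathlib

section
/- Let a be a 2-automatic sequence with values in a finite alphabet Δ. Then a is homogeneous if and only if there exist a finite group G, elements t_0, t_1 generating G, and a map τ : G → Δ such that a_n = τ(t_{d_0} t_{d_1} ⋯ t_{d_k}) for all n ≥ 1 (where d_k ⋯ d_0 are the base-2 digits of n, d_0 least significant), and such that the subgroup H = { h ∈ G : τ(h g) = τ(g) for all g ∈ G } is normal in G. Moreover, when a is homogeneous, G, t_0, t_1 and τ can be chosen so that H is the trivial subgroup. -/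
open scoped Classical

/-- `a k` encodes the term of index `k + 1` of a sequence `(a_n)_{n ≥ 1}` indexed from `1`.
`subSeq p a i j` encodes the subsequence `a^{(i,j)}` defined by `a^{(i,j)}_n = a_{p^i n + j}`
for `n ≥ 1`. -/
def subSeq (p : ℕ) {Δ : Type*} (a : ℕ → Δ) (i j : ℕ) : ℕ → Δ :=
  fun k => a (p ^ i * (k + 1) + j - 1)

/-- `N(a)`: the set of all subsequences `a^{(i,j)}` with `0 ≤ j < p^i`. -/
def NSet (p : ℕ) {Δ : Type*} (a : ℕ → Δ) : Set (ℕ → Δ) :=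
  {u | ∃ i j : ℕ, j < p ^ i ∧ u = subSeq p a i j}

/-- `a` is `p`-automatic iff `N(a)` is finite. -/
def IsAutomatic (p : ℕ) {Δ : Type*} (a : ℕ → Δ) : Prop :=
  (NSet p a).Finite

/-- `rel(a)`: the set of relations of `a`: pairs `(i,j)` with `j < p^i`, `(i,j) ≠ (0,0)`
and `a^{(i,j)} = a`. -/
def relSet (p : ℕ) {Δ : Type*} (a : ℕ → Δ) : Set (ℕ × ℕ) :=
  {ij | ij.2 < p ^ ij.1 ∧ ij ≠ (0, 0) ∧ subSeq p a ij.1 ij.2 = a}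

/-- `a` is homogeneous if every `u ∈ N(a)` satisfies `N(u) = N(a)` and `rel(u) = rel(a)`. -/
def Homogeneous (p : ℕ) {Δ : Type*} (a : ℕ → Δ) : Prop :=
  ∀ u ∈ NSet p a, NSet p u = NSet p a ∧ relSet p u = relSet p a

/-- The subgroup `H` of all `h ∈ G` such that `τ (h * g) = τ g` for all `g ∈ G`. -/
def tauStab {G : Type*} [Group G] {Δ : Type*} (τ : G → Δ) : Subgroup G where
  carrier := {h | ∀ g, τ (h * g) = τ g}
  one_mem' := by intro g; rw [one_mul]
  mul_mem' := by
    intro x y hx hy g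
    rw [mul_assoc, hx (y * g), hy g]
  inv_mem' := by
    intro x hx g
    have h1 := hx (x⁻¹ * g)
    rw [mul_inv_cancel_left] at h1
    exact h1.symm

/-- `cayleyWord2 t0 t1 n` is the element `t_{d_0} t_{d_1} ⋯ t_{d_k}` of `G`, where
`d_k ⋯ d_1 d_0` are the base-`2` digits of `n` (least significant first). -/
def cayleyWord2 {G : Type*} [Group G] (t0 t1 : G) (n : ℕ) : G :=
  (Nat.digits 2 n).foldl (fun g d => g * (if d = 0 then t0 else t1)) 1

/-- The generator attached to the base-`2` digit `d`. -/
def digitGen {G : Type*} (t0 t1 : G) (d : ℕ) : G := if d = 0 then t0 else t1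

/-- The product `t_{d_0} ⋯ t_{d_{i-1}}` over the `i` lowest base-`2` digits of `j`. -/
def paddedWord {G : Type*} [Group G] (t0 t1 : G) : ℕ → ℕ → G
  | 0, _ => 1
  | i + 1, j => digitGen t0 t1 (j % 2) * paddedWord t0 t1 i (j / 2)

theorem foldl_mul_eq {G α : Type*} [Group G] (f : α → G) (l : List α) (g : G) :
    l.foldl (fun x d => x * f d) g = g * l.foldl (fun x d => x * f d) 1 := by
  induction l generalizing g with
  | nil => simp
  | cons d l ih =>
    simp only [List.foldl_cons]
    rw [ih (g * f d), ih (1 * f d)]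
    simp [mul_assoc]

theorem cayleyWord2_two_mul_add {G : Type*} [Group G] (t0 t1 : G) {n d : ℕ} (hn : 0 < n)
    (hd : d < 2) :
    cayleyWord2 t0 t1 (2 * n + d) = digitGen t0 t1 d * cayleyWord2 t0 t1 n := by
  unfold cayleyWord2
  rw [add_comm, Nat.digits_add 2 one_lt_two d n hd (Or.inr hn.ne'), List.foldl_cons, foldl_mul_eq,
    one_mul]
  rfl

theorem cayleyWord2_one {G : Type*} [Group G] (t0 t1 : G) : cayleyWord2 t0 t1 1 = t1 := by
  simp [cayleyWord2]

theorem cayleyWord2_pow_mul_add {G : Type*} [Group G] (t0 t1 : G) {n : ℕ} (hn : 0 < n) {i j : ℕ}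
    (hj : j < 2 ^ i) :
    cayleyWord2 t0 t1 (2 ^ i * n + j) = paddedWord t0 t1 i j * cayleyWord2 t0 t1 n := by
  induction i generalizing j with
  | zero =>
    obtain rfl : j = 0 := by simpa using hj
    simp [paddedWord]
  | succ i ih =>
    have hj' : j / 2 < 2 ^ i := by rw [pow_succ] at hj; omega
    have hsplit : 2 ^ (i + 1) * n + j = 2 * (2 ^ i * n + j / 2) + j % 2 := by
      rw [pow_succ, mul_comm (2 ^ i) 2, mul_assoc]; omega
    have hpos : 0 < 2 ^ i * n + j / 2 := by positivity
    rw [hsplit, cayleyWord2_two_mul_add t0 t1 hpos (Nat.mod_lt _ two_pos), ih hj', paddedWord,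
      mul_assoc]

theorem paddedWord_add {G : Type*} [Group G] (t0 t1 : G) {i j : ℕ} (hj : j < 2 ^ i) (k l : ℕ) :
    paddedWord t0 t1 (i + k) (2 ^ i * l + j) = paddedWord t0 t1 i j * paddedWord t0 t1 k l := by
  induction i generalizing j with
  | zero =>
    obtain rfl : j = 0 := by simpa using hj
    simp [paddedWord]
  | succ i ih =>
    have hj' : j / 2 < 2 ^ i := by rw [pow_succ] at hj; omega
    have hsplit : 2 ^ (i + 1) * l + j = 2 * (2 ^ i * l) + j := by ring
    rw [hsplit, show i + 1 + k = i + k + 1 by ring, paddedWord, paddedWord,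
      show (2 * (2 ^ i * l) + j) % 2 = j % 2 by omega,
      show (2 * (2 ^ i * l) + j) / 2 = 2 ^ i * l + j / 2 by omega, ih hj', mul_assoc]

theorem pow_mul_add_lt {p i j k l : ℕ} (hj : j < p ^ i) (hl : l < p ^ k) :
    p ^ i * l + j < p ^ (i + k) := by
  calc p ^ i * l + j < p ^ i * (l + 1) := by rw [mul_add_one]; omega
    _ ≤ p ^ i * p ^ k := Nat.mul_le_mul_left _ hl
    _ = p ^ (i + k) := (pow_add p i k).symm

theorem exists_paddedWord_eq {G : Type*} [Group G] [Finite G] {t0 t1 : G}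
    (hgen : Subgroup.closure {t0, t1} = ⊤) (g : G) :
    ∃ i j, j < 2 ^ i ∧ paddedWord t0 t1 i j = g := by
  have hg : g ∈ Submonoid.closure ({t0, t1} : Set G) := by
    rw [← Subgroup.closure_toSubmonoid_of_finite, hgen]
    trivial
  induction hg using Submonoid.closure_induction with
  | mem x hx =>
    rcases hx with rfl | rfl
    · exact ⟨1, 0, by simp, by simp [paddedWord, digitGen]⟩
    · exact ⟨1, 1, by simp, by simp [paddedWord, digitGen]⟩
  | one => exact ⟨0, 0, by simp, rfl⟩
  | mul x y _ _ hx hy =>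
    obtain ⟨i, j, hj, rfl⟩ := hx
    obtain ⟨k, l, hl, rfl⟩ := hy
    exact ⟨i + k, 2 ^ i * l + j, pow_mul_add_lt hj hl, paddedWord_add t0 t1 hj k l⟩

theorem subSeq_zero_zero {p : ℕ} {Δ : Type*} (a : ℕ → Δ) : subSeq p a 0 0 = a := by
  funext k
  simp [subSeq]

theorem subSeq_subSeq {p : ℕ} (hp : 0 < p) {Δ : Type*} (a : ℕ → Δ) (i j k l : ℕ) :
    subSeq p (subSeq p a i j) k l = subSeq p a (i + k) (p ^ i * l + j) := by
  funext n
  have hpos : 0 < p ^ k * (n + 1) := by positivity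
  simp only [subSeq]
  rw [show p ^ k * (n + 1) + l - 1 + 1 = p ^ k * (n + 1) + l by omega, pow_add]
  congr 2
  ring

theorem self_mem_NSet (p : ℕ) {Δ : Type*} (a : ℕ → Δ) : a ∈ NSet p a :=
  ⟨0, 0, by simp, (subSeq_zero_zero a).symm⟩

theorem subSeq_mem_NSet {p : ℕ} (hp : 0 < p) {Δ : Type*} {a u : ℕ → Δ} (hu : u ∈ NSet p a)
    {i j : ℕ} (hj : j < p ^ i) : subSeq p u i j ∈ NSet p a := by
  obtain ⟨k, l, hl, rfl⟩ := hu
  exact ⟨k + i, p ^ k * j + l, pow_mul_add_lt hl hj, subSeq_subSeq hp a k l i j⟩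

/-- The sequence produced by the Cayley automaton started in the state `g`. -/
def cayleySeq {G : Type*} [Group G] {Δ : Type*} (t0 t1 : G) (τ : G → Δ) (g : G) : ℕ → Δ :=
  fun k => τ (g * cayleyWord2 t0 t1 (k + 1))

theorem subSeq_cayleySeq {G : Type*} [Group G] {Δ : Type*} (t0 t1 : G) (τ : G → Δ) (g : G)
    {i j : ℕ} (hj : j < 2 ^ i) :
    subSeq 2 (cayleySeq t0 t1 τ g) i j = cayleySeq t0 t1 τ (g * paddedWord t0 t1 i j) := by
  funext k
  have hpos : 0 < 2 ^ i * (k + 1) := by positivity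
  simp only [subSeq, cayleySeq]
  rw [show 2 ^ i * (k + 1) + j - 1 + 1 = 2 ^ i * (k + 1) + j by omega,
    cayleyWord2_pow_mul_add t0 t1 k.succ_pos hj, mul_assoc]

theorem NSet_cayleySeq {G : Type*} [Group G] [Finite G] {Δ : Type*} {t0 t1 : G}
    (hgen : Subgroup.closure {t0, t1} = ⊤) (τ : G → Δ) (g : G) :
    NSet 2 (cayleySeq t0 t1 τ g) = Set.range (cayleySeq t0 t1 τ) := by
  ext u
  constructor
  · rintro ⟨i, j, hj, rfl⟩
    exact ⟨_, (subSeq_cayleySeq t0 t1 τ g hj).symm⟩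
  · rintro ⟨x, rfl⟩
    obtain ⟨i, j, hj, hx⟩ := exists_paddedWord_eq hgen (g⁻¹ * x)
    exact ⟨i, j, hj, by rw [subSeq_cayleySeq t0 t1 τ g hj, hx, mul_inv_cancel_left]⟩

theorem exists_cayleyWord2_eq {G : Type*} [Group G] [Finite G] {t0 t1 : G}
    (hgen : Subgroup.closure {t0, t1} = ⊤) (g : G) : ∃ k, cayleyWord2 t0 t1 (k + 1) = g := by
  obtain ⟨i, j, hj, hg⟩ := exists_paddedWord_eq hgen (g * t1⁻¹)
  have hpos : 0 < 2 ^ i := by positivity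
  refine ⟨2 ^ i * 1 + j - 1, ?_⟩
  rw [show 2 ^ i * 1 + j - 1 + 1 = 2 ^ i * 1 + j by omega,
    cayleyWord2_pow_mul_add t0 t1 one_pos hj, hg, cayleyWord2_one, inv_mul_cancel_right]

theorem cayleySeq_mul_eq_iff {G : Type*} [Group G] [Finite G] {Δ : Type*} {t0 t1 : G}
    (hgen : Subgroup.closure {t0, t1} = ⊤) (τ : G → Δ) [hH : (tauStab τ).Normal] (g h : G) :
    cayleySeq t0 t1 τ (g * h) = cayleySeq t0 t1 τ g ↔ h ∈ tauStab τ := by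
  have hmem : h ∈ tauStab τ ↔ ∀ x, τ (g * h * g⁻¹ * x) = τ x :=
    ⟨fun hh => hH.conj_mem h hh g, fun hh => by
      have := hH.conj_mem (g * h * g⁻¹) hh g⁻¹
      simpa [mul_assoc] using this⟩
  rw [hmem]
  constructor
  · intro heq x
    obtain ⟨k, hk⟩ := exists_cayleyWord2_eq hgen (g⁻¹ * x)
    have := congrFun heq k
    simp only [cayleySeq, hk] at this
    simpa [mul_assoc] using this
  · intro hall
    funext k
    have := hall (g * cayleyWord2 t0 t1 (k + 1))
    simpa [mul_assoc, cayleySeq] using this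

theorem homogeneous_cayleySeq {G : Type*} [Group G] [Finite G] {Δ : Type*} {t0 t1 : G}
    (hgen : Subgroup.closure {t0, t1} = ⊤) (τ : G → Δ) [(tauStab τ).Normal] (g : G) :
    Homogeneous 2 (cayleySeq t0 t1 τ g) := by
  rintro u ⟨i, j, hj, rfl⟩
  rw [subSeq_cayleySeq t0 t1 τ g hj]
  refine ⟨by rw [NSet_cayleySeq hgen, NSet_cayleySeq hgen], ?_⟩
  ext ⟨k, l⟩
  refine and_congr_right fun hl => and_congr_right fun _ => ?_
  rw [subSeq_cayleySeq t0 t1 τ _ hl, subSeq_cayleySeq t0 t1 τ _ hl, cayleySeq_mul_eq_iff hgen,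
    cayleySeq_mul_eq_iff hgen]

theorem exists_iterate_eq_subSeq {p : ℕ} (hp : 0 < p) {Δ X : Type*} {v : X → ℕ → Δ} {T : X → X}
    {d : ℕ} (hd : d < p) (hT : ∀ x, v (T x) = subSeq p (v x) 1 d) (m : ℕ) :
    ∃ j < p ^ m, ∀ x, v (T^[m] x) = subSeq p (v x) m j := by
  induction m with
  | zero => exact ⟨0, by simp, fun x => (subSeq_zero_zero _).symm⟩
  | succ m ih =>
    obtain ⟨j, hj, h⟩ := ih
    refine ⟨p ^ m * d + j, pow_mul_add_lt hj (by simpa using hd), fun x => ?_⟩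
    rw [Function.iterate_succ_apply', hT, h, subSeq_subSeq hp]

/-- When all sequences `v x` have the same relations, each digit map on the finite index set
has a power equal to the identity, hence is bijective. -/
theorem bijective_of_relSet_eq {p : ℕ} (hp : 0 < p) {Δ X : Type*} [Finite X] {v : X → ℕ → Δ}
    (hv : Function.Injective v) (hrel : ∀ x y, relSet p (v x) = relSet p (v y)) {T : X → X}
    {d : ℕ} (hd : d < p) (hT : ∀ x, v (T x) = subSeq p (v x) 1 d) : Function.Bijective T := by
  refine Finite.injective_iff_bijective.mp fun x y hxy => ?_
  obtain ⟨k, l, hkl, heq⟩ : ∃ k l, k < l ∧ T^[k] x = T^[l] x := by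
    obtain ⟨k, l, hne, heq⟩ := Finite.exists_ne_map_eq_of_infinite fun m => T^[m] x
    rcases hne.lt_or_gt with h | h
    exacts [⟨k, l, h, heq⟩, ⟨l, k, h, heq.symm⟩]
  obtain ⟨m, rfl⟩ : ∃ m, l = m + 1 + k := ⟨l - k - 1, by omega⟩
  obtain ⟨j, hj, h⟩ := exists_iterate_eq_subSeq hp hd hT (m + 1)
  have hfix : (m + 1, j) ∈ relSet p (v (T^[k] x)) :=
    ⟨hj, by simp, by rw [← h, ← Function.iterate_add_apply, ← heq]⟩
  have hid : ∀ z, T^[m + 1] z = z := fun z => hv <| by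
    rw [h]
    exact (hrel _ z ▸ hfix).2.2
  rw [← hid x, ← hid y, Function.iterate_succ_apply, hxy, Function.iterate_succ_apply]

theorem exists_group_tauStab_eq_bot {Δ : Type*} {a : ℕ → Δ} (ha : IsAutomatic 2 a)
    (hom : Homogeneous 2 a) :
    ∃ (G : GrpCat.{0}) (t0 t1 : ↥G) (τ : ↥G → Δ), Finite ↥G ∧
      Subgroup.closure {t0, t1} = ⊤ ∧
      (∀ k : ℕ, a k = τ (cayleyWord2 t0 t1 (k + 1))) ∧
      tauStab τ = ⊥ := by
  have : Finite (NSet 2 a) := ha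
  obtain ⟨n, ⟨e⟩⟩ := Finite.exists_equiv_fin (NSet 2 a)
  let v : Fin n → ℕ → Δ := fun x => e.symm x
  have hv : Function.Injective v := Subtype.val_injective.comp e.symm.injective
  have hmem : ∀ x, v x ∈ NSet 2 a := fun x => (e.symm x).2
  have hsurj : ∀ u ∈ NSet 2 a, ∃ x, v x = u := fun u hu => ⟨e ⟨u, hu⟩, by simp [v]⟩
  have hrel : ∀ x y, relSet 2 (v x) = relSet 2 (v y) := fun x y =>
    (hom _ (hmem x)).2.trans (hom _ (hmem y)).2.symm
  have hperm : ∀ d < 2, ∃ P : Equiv.Perm (Fin n), ∀ x, v (P x) = subSeq 2 (v x) 1 d := by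
    intro d hd
    have hstep : ∀ x, ∃ y, v y = subSeq 2 (v x) 1 d := fun x =>
      hsurj _ (subSeq_mem_NSet two_pos (hmem x) (by simpa using hd))
    choose T hT using hstep
    exact ⟨Equiv.ofBijective T (bijective_of_relSet_eq two_pos hv hrel hd hT), hT⟩
  obtain ⟨P0, hP0⟩ := hperm 0 two_pos
  obtain ⟨P1, hP1⟩ := hperm 1 one_lt_two
  have : Finite (Equiv.Perm (Fin n))ᵐᵒᵖ := Finite.of_equiv _ MulOpposite.opEquiv
  let s : Set (Equiv.Perm (Fin n))ᵐᵒᵖ := {MulOpposite.op P0, MulOpposite.op P1}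
  let t0 : Subgroup.closure s := ⟨.op P0, Subgroup.subset_closure (by simp [s])⟩
  let t1 : Subgroup.closure s := ⟨.op P1, Subgroup.subset_closure (by simp [s])⟩
  have hgen : Subgroup.closure {t0, t1} = ⊤ := by
    rw [← Subgroup.closure_closure_coe_preimage (k := s)]
    congr 1
    ext x
    simp [s, t0, t1, Subtype.ext_iff]
  have hdigit : ∀ d < 2, ∀ x, v ((digitGen t0 t1 d).1.unop x) = subSeq 2 (v x) 1 d := by
    intro d hd x
    interval_cases d
    · exact hP0 x
    · exact hP1 x
  have hword : ∀ i j, j < 2 ^ i → ∀ x,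
      v ((paddedWord t0 t1 i j).1.unop x) = subSeq 2 (v x) i j := by
    intro i
    induction i with
    | zero =>
      intro j hj x
      obtain rfl : j = 0 := by simpa using hj
      exact (subSeq_zero_zero _).symm
    | succ i ih =>
      intro j hj x
      have hj' : j / 2 < 2 ^ i := by rw [pow_succ] at hj; omega
      have hcomp : (paddedWord t0 t1 (i + 1) j).1.unop x =
        (paddedWord t0 t1 i (j / 2)).1.unop ((digitGen t0 t1 (j % 2)).1.unop x) := rfl
      rw [hcomp, ih _ hj', hdigit _ (Nat.mod_lt _ two_pos), subSeq_subSeq two_pos, pow_one,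
        Nat.div_add_mod, add_comm]
  obtain ⟨x₀, hx₀⟩ := hsurj a (self_mem_NSet 2 a)
  have hfree : ∀ g : Subgroup.closure s, g.1.unop x₀ = x₀ → g = 1 := by
    intro g hg
    obtain ⟨i, j, hj, rfl⟩ := exists_paddedWord_eq hgen g
    rcases i with _ | i
    · rfl
    have hfix : (i + 1, j) ∈ relSet 2 (v x₀) := ⟨hj, by simp, by rw [← hword _ _ hj, hg]⟩
    refine Subtype.ext (MulOpposite.unop_injective (Equiv.ext fun y => hv ?_))
    rw [hword _ _ hj]
    exact (hrel x₀ y ▸ hfix).2.2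
  let τ : Subgroup.closure s → Δ := fun g => v ((g * t1⁻¹).1.unop x₀) 0
  have hτ : ∀ (g : Subgroup.closure s) (k : ℕ),
      v (g.1.unop x₀) k = τ (g * cayleyWord2 t0 t1 (k + 1)) := by
    intro g k
    have hlog : 2 ^ Nat.log 2 (k + 1) ≤ k + 1 := Nat.pow_log_le_self 2 k.succ_ne_zero
    have hlt : k + 1 < 2 ^ (Nat.log 2 (k + 1) + 1) := Nat.lt_pow_succ_log_self one_lt_two _
    obtain ⟨j, hj⟩ := Nat.exists_eq_add_of_le hlog
    generalize Nat.log 2 (k + 1) = i at hj hlt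
    have hj' : j < 2 ^ i := by rw [pow_succ] at hlt; omega
    have hk : k + 1 = 2 ^ i * 1 + j := by omega
    rw [hk, cayleyWord2_pow_mul_add t0 t1 one_pos hj', cayleyWord2_one]
    have hcancel : g * (paddedWord t0 t1 i j * t1) * t1⁻¹ = g * paddedWord t0 t1 i j := by group
    have hcomp : (g * paddedWord t0 t1 i j).1.unop x₀ =
      (paddedWord t0 t1 i j).1.unop (g.1.unop x₀) := rfl
    simp only [τ]
    rw [hcancel, hcomp, hword _ _ hj']
    simp only [subSeq]
    congr 1
    omega
  refine ⟨GrpCat.of (Subgroup.closure s), t0, t1, τ, inferInstanceAs (Finite (Subgroup.closure s)),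
    hgen, fun k => ?_, ?_⟩
  · have := hτ 1 k
    rw [one_mul] at this
    rw [← hx₀]
    exact this
  · refine (Subgroup.eq_bot_iff_forall _).mpr fun h hh => hfree h (hv (funext fun k => ?_))
    have h1 := hτ 1 k
    rw [one_mul] at h1
    exact (hτ h k).trans ((hh _).trans h1.symm)

/-- A `2`-automatic sequence is homogeneous iff it is produced by an automaton whose underlying
graph is the Cayley graph of a finite group `G` with generators `t0, t1` (initial state `1`,
labeling map `τ`), where the subgroup `H = {h | ∀ g, τ (h g) = τ g}` is normal in `G`;
moreover, when `a` is homogeneous, the data can be chosen with `H` trivial. -/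
theorem stmt_9 {Δ : Type*} [Finite Δ] (a : ℕ → Δ) (ha : IsAutomatic 2 a) :
    (Homogeneous 2 a ↔
      ∃ (G : GrpCat.{0}) (t0 t1 : ↥G) (τ : ↥G → Δ), Finite ↥G ∧
        Subgroup.closure {t0, t1} = ⊤ ∧
        (∀ k : ℕ, a k = τ (cayleyWord2 t0 t1 (k + 1))) ∧
        (tauStab τ).Normal) ∧
    (Homogeneous 2 a →
      ∃ (G : GrpCat.{0}) (t0 t1 : ↥G) (τ : ↥G → Δ), Finite ↥G ∧
        Subgroup.closure {t0, t1} = ⊤ ∧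
        (∀ k : ℕ, a k = τ (cayleyWord2 t0 t1 (k + 1))) ∧
        tauStab τ = ⊥) := by
  refine ⟨⟨fun hom => ?_, ?_⟩, exists_group_tauStab_eq_bot ha⟩
  · obtain ⟨G, t0, t1, τ, hfin, hgen, hτ, hbot⟩ := exists_group_tauStab_eq_bot ha hom
    exact ⟨G, t0, t1, τ, hfin, hgen, hτ, hbot ▸ inferInstance⟩
  · rintro ⟨G, t0, t1, τ, hfin, hgen, hτ, hnormal⟩
    obtain rfl : a = cayleySeq t0 t1 τ 1 := funext fun k => by rw [hτ, cayleySeq, one_mul]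
    exact homogeneous_cayleySeq hgen τ 1
end

section
/- Let p ≥ 2 and let a be a p-automatic sequence with values in a commutative ring R. Then for every u ∈ N(a), the following identity holds in the multivariate power series ring R[[x_0, …, x_{p−1}]]: L(u, x_0, …, x_{p−1}) = u_1 x_1 + u_2 x_2 + ⋯ + u_{p−1} x_{p−1} + Σ_{i=0}^{p−1} x_i · L(t_i(u), x_0, …, x_{p−1}), where u_i denotes the term of u of index i. -/
open scoped Classical

/-- `L(u, x_0, …, x_{p-1}) = ∑_{n ≥ 1} u_n x_0^{ℓ_0(n)} ⋯ x_{p-1}^{ℓ_{p-1}(n)}`, where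
`ℓ_i(n)` is the number of occurrences of the digit `i` in the base-`p` expansion of `n`.
The coefficient of the monomial with exponents `m` is the (finite) sum of the terms `u_n` over
those `n` whose digit counts are given by `m`. -/
noncomputable def Lseries (p : ℕ) {R : Type*} [CommRing R] (u : ℕ → R) :
    MvPowerSeries (Fin p) R :=
  (fun m => ∑ n ∈ (Finset.range (p ^ (Finset.univ.sum fun i => m i))).filter
      (fun n => ∀ i : Fin p, (Nat.digits p (n + 1)).count (i : ℕ) = m i), u n :
    (Fin p →₀ ℕ) → R)

/-- The vector of digit counts of `n` in base `p`. -/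
noncomputable def digitCount (p n : ℕ) : Fin p →₀ ℕ :=
  Finsupp.equivFunOnFinite.symm fun i => (Nat.digits p n).count (i : ℕ)

theorem digitCount_apply (p n : ℕ) (i : Fin p) :
    digitCount p n i = (Nat.digits p n).count (i : ℕ) := rfl

theorem digitCount_zero (p : ℕ) : digitCount p 0 = 0 := by
  ext i
  simp [digitCount_apply]

theorem digitCount_mul_add {p : ℕ} (hp : 2 ≤ p) (q : ℕ) (i : Fin p)
    (h : (i : ℕ) ≠ 0 ∨ q ≠ 0) :
    digitCount p (p * q + i) = digitCount p q + Finsupp.single i 1 := by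
  ext j
  rw [digitCount_apply, add_comm, Nat.digits_add p hp i q i.isLt h, List.count_cons,
    Finsupp.add_apply, digitCount_apply, Finsupp.single_apply]
  simp [Fin.ext_iff]

theorem sum_digitCount {p : ℕ} (hp : 2 ≤ p) (n : ℕ) :
    ∑ i, digitCount p n i = (Nat.digits p n).length := by
  simp only [digitCount_apply]
  rw [← Finset.sum_range (fun i => (Nat.digits p n).count i)]
  simpa using Multiset.sum_count_eq_card (s := Finset.range p)
    (m := (Nat.digits p n : Multiset ℕ))
    (fun d hd => Finset.mem_range.2 (Nat.digits_lt_base hp hd))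

theorem lt_pow_sum_digitCount {p : ℕ} (hp : 2 ≤ p) (n : ℕ) :
    n < p ^ ∑ i, digitCount p n i := by
  rw [sum_digitCount hp]
  exact Nat.lt_base_pow_length_digits hp

/-- Splitting a sum over `range (p * K)` according to the residue modulo `p`. -/
theorem sum_range_mul_eq_sum_sum_fin {M : Type*} [AddCommMonoid M] (p K : ℕ) (f : ℕ → M) :
    ∑ n ∈ Finset.range (p * K), f n = ∑ i : Fin p, ∑ q ∈ Finset.range K, f (p * q + i) := by
  rw [Finset.sum_comm]
  induction K with
  | zero => simp
  | succ K ih =>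
    rw [mul_add_one, Finset.sum_range_add, ih, Finset.sum_range_succ,
      Finset.sum_range (fun i => f (p * K + i))]

/-- The coefficients of `Lseries p u` as sums over any sufficiently long range. -/
theorem coeff_Lseries {p : ℕ} (hp : 2 ≤ p) {R : Type*} [CommRing R] (u : ℕ → R)
    (m : Fin p →₀ ℕ) {K : ℕ} (hK : p ^ (∑ i, m i) ≤ K) :
    MvPowerSeries.coeff m (Lseries p u) =
      ∑ n ∈ Finset.range K, if n ≠ 0 ∧ digitCount p n = m then u (n - 1) else 0 := by
  rw [← Finset.sum_filter]
  change ∑ n ∈ (Finset.range (p ^ ∑ i, m i)).filter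
    (fun n => ∀ i : Fin p, (Nat.digits p (n + 1)).count (i : ℕ) = m i), u n = _
  refine Finset.sum_nbij' (· + 1) (· - 1) ?_ ?_ ?_ ?_ ?_
  · intro n hn
    have h : digitCount p (n + 1) = m := Finsupp.ext (Finset.mem_filter.1 hn).2
    have hlt := lt_pow_sum_digitCount hp (n + 1)
    rw [h] at hlt
    simpa [h] using hlt.trans_le hK
  · intro n hn
    obtain ⟨-, h0, h⟩ := Finset.mem_filter.1 hn
    have hlt := lt_pow_sum_digitCount hp n
    rw [h] at hlt
    refine Finset.mem_filter.2 ⟨Finset.mem_range.2 (by omega), fun i => ?_⟩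
    rw [Nat.sub_add_cancel (Nat.pos_of_ne_zero h0), ← h, digitCount_apply]
  · simp
  · intro n hn
    exact Nat.sub_add_cancel (Nat.pos_of_ne_zero (Finset.mem_filter.1 hn).2.1)
  · simp

theorem coeff_X_mul_Lseries {p : ℕ} (hp : 2 ≤ p) {R : Type*} [CommRing R] (u : ℕ → R)
    (i : Fin p) (m : Fin p →₀ ℕ) {K : ℕ} (hK : p ^ (∑ i, m i) ≤ K) :
    MvPowerSeries.coeff m (MvPowerSeries.X i * Lseries p u) =
      ∑ q ∈ Finset.range K,
        if q ≠ 0 ∧ digitCount p q + Finsupp.single i 1 = m then u (q - 1) else 0 := by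
  rw [MvPowerSeries.X, MvPowerSeries.coeff_monomial_mul]
  split_ifs with h
  · have hle : ∑ j, (m - Finsupp.single i 1 : Fin p →₀ ℕ) j ≤ ∑ j, m j :=
      Finset.sum_le_sum fun j _ => tsub_le_self
    rw [one_mul, coeff_Lseries hp u _ ((Nat.pow_le_pow_right (by omega) hle).trans hK)]
    simp only [eq_tsub_iff_add_eq_of_le h]
  · refine (Finset.sum_eq_zero fun q _ => if_neg ?_).symm
    rintro ⟨-, rfl⟩
    exact h le_add_self

theorem Lseries_eq {p : ℕ} (hp : 2 ≤ p) {R : Type*} [CommRing R] (u : ℕ → R) :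
    Lseries p u =
      (∑ i ∈ Finset.univ.filter (fun i : Fin p => (i : ℕ) ≠ 0),
        MvPowerSeries.C (σ := Fin p) (R := R) (u ((i : ℕ) - 1)) * MvPowerSeries.X i) +
      ∑ i : Fin p, MvPowerSeries.X i * Lseries p (subSeq p u 1 (i : ℕ)) := by
  ext m
  have hK : 0 < p ^ ∑ i, m i := Nat.pow_pos (by omega)
  rw [coeff_Lseries hp u m (Nat.le_mul_of_pos_left _ (by omega : 0 < p)),
    sum_range_mul_eq_sum_sum_fin, map_add, map_sum, map_sum, Finset.sum_filter,
    ← Finset.sum_add_distrib]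
  refine Finset.sum_congr rfl fun i _ => ?_
  rw [coeff_X_mul_Lseries hp _ i m le_rfl, MvPowerSeries.coeff_C_mul, MvPowerSeries.coeff_X,
    ← Nat.sub_add_cancel hK, Finset.sum_range_succ', Finset.sum_range_succ', add_comm]
  congr 1
  · by_cases hi : (i : ℕ) = 0
    · simp [hi]
    · have h := digitCount_mul_add hp 0 i (Or.inl hi)
      rw [digitCount_zero, zero_add] at h
      simp only [h]
      simp [hi, eq_comm]
  · rw [if_neg (by simp), add_zero]
    refine Finset.sum_congr rfl fun q _ => ?_
    rw [digitCount_mul_add hp (q + 1) i (Or.inr q.succ_ne_zero)]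
    have h0 : p ≠ 0 := by omega
    simp [subSeq, h0]

/-- The fundamental recursion: for every `u ∈ N(a)`,
`L(u) = u_1 x_1 + ⋯ + u_{p-1} x_{p-1} + ∑_{i=0}^{p-1} x_i L(t_i(u))`. -/
theorem stmt_14 {p : ℕ} (hp : 2 ≤ p) {R : Type*} [CommRing R] (a : ℕ → R)
    (ha : IsAutomatic p a) :
    ∀ u ∈ NSet p a,
      Lseries p u =
        (∑ i ∈ Finset.univ.filter (fun i : Fin p => (i : ℕ) ≠ 0),
          MvPowerSeries.C (σ := Fin p) (R := R) (u ((i : ℕ) - 1)) * MvPowerSeries.X i) +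
        ∑ i : Fin p, MvPowerSeries.X i * Lseries p (subSeq p u 1 (i : ℕ)) := by
  exact fun u _ => Lseries_eq hp u
end

section
/- Let p ≥ 2 and let a be a p-automatic sequence with values in a commutative ring R. Let A be the integer matrix indexed by N(a) with A_{u,v} = #{ i : 0 ≤ i < p, t_i(u) = v } (the adjacency matrix of Γ(a)), and let D(x) = det(I − xA) ∈ ℤ[x], a polynomial with D(0) = 1. Then: (1) for every u ∈ N(a), L(u, x) = x·(u_1 + u_2 + ⋯ + u_{p−1}) + x · Σ_{i=0}^{p−1} L(t_i(u), x) in R[[x]], i.e. the column vector Λ = (L(u,x))_{u ∈ N(a)} satisfies (I − xA)Λ = xT where T_u = u_1 + ⋯ + u_{p−1}; (2) consequently D(x) · L(a, x) is a polynomial in R[x], so L(a,x) is a rational fraction. -/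
open scoped Classical

/-- `L(u, x) = ∑_{n ≥ 1} u_n x^{ℓ(n)}` where `ℓ(n)` is the number of base-`p` digits of `n`:
the coefficient of `x^n` is the sum of the `u_m` over the `m` of length `n`. -/
noncomputable def LxSeries (p : ℕ) {R : Type*} [CommRing R] (u : ℕ → R) : PowerSeries R :=
  PowerSeries.mk fun n =>
    ∑ m ∈ (Finset.range (p ^ n)).filter (fun m => (Nat.digits p (m + 1)).length = n), u m

/-- `D(x) = det(I - x A)` where `A` is the adjacency matrix of `Γ(a)`:
`A_{u,v} = #\{i < p : t_i(u) = v\}`. -/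
noncomputable def adjDet (p : ℕ) {Δ : Type*} (a : ℕ → Δ) (ha : IsAutomatic p a) :
    Polynomial ℤ :=
  letI : Fintype ↥(NSet p a) := Set.Finite.fintype ha
  letI : DecidableEq ↥(NSet p a) := Classical.decEq _
  Matrix.det (1 - Matrix.of (fun u v : ↥(NSet p a) =>
    Polynomial.C (((Finset.univ.filter
        (fun i : Fin p => subSeq p (u : ℕ → Δ) 1 (i : ℕ) = (v : ℕ → Δ))).card : ℤ))
      * Polynomial.X))

theorem sum_Ico_mul_eq_sum_sum {M : Type*} [AddCommMonoid M] (p A B : ℕ) (h : A ≤ B)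
    (f : ℕ → M) :
    ∑ k ∈ Finset.Ico (p * A) (p * B), f k =
      ∑ k ∈ Finset.Ico A B, ∑ i ∈ Finset.range p, f (p * k + i) := by
  induction B, h using Nat.le_induction with
  | base => simp
  | succ B h ih =>
    rw [Finset.sum_Ico_succ_top h, ← ih, ← Finset.sum_Ico_consecutive f
      (Nat.mul_le_mul_left p h) (Nat.mul_le_mul_left p B.le_succ)]
    congr 1
    rw [Finset.sum_Ico_eq_sum_range, show p * (B + 1) - p * B = p by
      rw [Nat.mul_succ, Nat.add_sub_cancel_left]]

theorem coeff_zero_LxSeries (p : ℕ) {R : Type*} [CommRing R] (u : ℕ → R) :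
    PowerSeries.coeff 0 (LxSeries p u) = 0 := by
  simp [LxSeries, Finset.sum_filter, Nat.digits_ne_nil_iff_ne_zero]

theorem coeff_succ_LxSeries {p : ℕ} (hp : 2 ≤ p) {R : Type*} [CommRing R] (u : ℕ → R) (n : ℕ) :
    PowerSeries.coeff (n + 1) (LxSeries p u) =
      ∑ k ∈ Finset.Ico (p ^ n) (p ^ (n + 1)), u (k - 1) := by
  rw [LxSeries, PowerSeries.coeff_mk]
  have length_iff (m : ℕ) : (Nat.digits p (m + 1)).length = n + 1 ↔
      p ^ n ≤ m + 1 ∧ m + 1 < p ^ (n + 1) := by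
    rw [← Nat.lt_digits_length_iff hp, ← Nat.digits_length_le_iff hp]
    omega
  have hpos : 0 < p ^ n := by positivity
  refine Finset.sum_bij' (fun m _ => m + 1) (fun k _ => k - 1) ?_ ?_ ?_ ?_ ?_
  · intro m hm
    simpa [length_iff] using (Finset.mem_filter.mp hm).2
  · intro k hk
    have hk' := Finset.mem_Ico.mp hk
    rw [Finset.mem_filter, length_iff, Finset.mem_range]
    omega
  · simp
  · intro k hk
    have hk' := Finset.mem_Ico.mp hk
    omega
  · simp

theorem LxSeries_eq {p : ℕ} (hp : 2 ≤ p) {R : Type*} [CommRing R] (u : ℕ → R) :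
    LxSeries p u =
      PowerSeries.X * PowerSeries.C (R := R) (∑ i ∈ Finset.range (p - 1), u i) +
      PowerSeries.X * ∑ i ∈ Finset.range p, LxSeries p (subSeq p u 1 i) := by
  ext n
  rcases n with _ | n
  · simp [coeff_zero_LxSeries]
  rw [map_add, PowerSeries.coeff_succ_X_mul, PowerSeries.coeff_succ_X_mul,
    map_sum (PowerSeries.coeff n),
    PowerSeries.coeff_C, coeff_succ_LxSeries hp]
  rcases n with _ | n
  · simp only [coeff_zero_LxSeries, Finset.sum_const_zero, if_true, add_zero, zero_add, pow_zero,
      pow_one]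
    rw [Finset.sum_Ico_eq_sum_range]
    simp
  · simp only [coeff_succ_LxSeries hp, Nat.add_eq_zero_iff, one_ne_zero, and_false, if_false,
      zero_add]
    rw [pow_succ' p n, pow_succ' p (n + 1), sum_Ico_mul_eq_sum_sum p _ _
      (Nat.pow_le_pow_right (by omega) n.le_succ), Finset.sum_comm, ← pow_succ' p n]
    refine Finset.sum_congr rfl fun i _ => Finset.sum_congr rfl fun k hk => ?_
    have hpos : 0 < p ^ n := by positivity
    have hk' := Finset.mem_Ico.mp hk
    rw [subSeq, Nat.sub_add_cancel (by omega), pow_one]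

theorem subSeq_one_mem_NSet {p : ℕ} {Δ : Type*} {a u : ℕ → Δ} (hu : u ∈ NSet p a)
    {i : ℕ} (hi : i < p) : subSeq p u 1 i ∈ NSet p a := by
  obtain ⟨r, j, hj, rfl⟩ := hu
  refine ⟨r + 1, p ^ r * i + j, ?_, ?_⟩
  · calc p ^ r * i + j < p ^ r * (i + 1) := by rw [Nat.mul_succ]; omega
      _ ≤ p ^ (r + 1) := by rw [pow_succ]; exact Nat.mul_le_mul_left _ hi
  · funext k
    have hpos : 0 < p * (k + 1) := Nat.mul_pos (by omega) k.succ_pos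
    simp only [subSeq, pow_one]
    rw [Nat.sub_add_cancel (by omega)]
    congr 2
    ring

/-- If `M` maps to a matrix sending `v` to `w` and `w` lies in the image of the base ring, then
`det M` times each entry of `v` lies in that image. -/
theorem exists_det_mul_eq {ι S K : Type*} [Fintype ι] [DecidableEq ι] [CommRing S] [CommRing K]
    (f : S →+* K) (M : Matrix ι ι S) (v : ι → K) (w : ι → S)
    (h : (M.map f).mulVec v = f ∘ w) (i : ι) : ∃ s, f M.det * v i = f s := by
  refine ⟨(M.adjugate.mulVec w) i, ?_⟩
  have key := congrArg (fun z => (M.map f).adjugate.mulVec z) h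
  simp only [Matrix.mulVec_mulVec, Matrix.adjugate_mul, Matrix.smul_mulVec, Matrix.one_mulVec]
    at key
  have hi := congrFun key i
  rw [Pi.smul_apply, smul_eq_mul] at hi
  rw [RingHom.map_det, RingHom.mapMatrix_apply, hi, RingHom.map_mulVec,
    ← RingHom.mapMatrix_apply, ← RingHom.map_adjugate]
  rfl

theorem eval_zero_adjDet (p : ℕ) {Δ : Type*} (a : ℕ → Δ) (ha : IsAutomatic p a) :
    (adjDet p a ha).eval 0 = 1 := by
  let _ : Fintype ↥(NSet p a) := Set.Finite.fintype ha
  let _ : DecidableEq ↥(NSet p a) := Classical.decEq _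
  rw [adjDet, ← Polynomial.coe_evalRingHom, RingHom.map_det, map_sub, map_one]
  convert Matrix.det_one (n := ↥(NSet p a)) (R := ℤ)
  rw [sub_eq_self]
  ext u v
  simp

theorem exists_polynomial_adjDet_mul_LxSeries {p : ℕ} (hp : 2 ≤ p) {R : Type*} [CommRing R]
    (a : ℕ → R) (ha : IsAutomatic p a) :
    ∃ N : Polynomial R,
      (((adjDet p a ha).map (Int.castRingHom R) : Polynomial R) : PowerSeries R)
          * LxSeries p a
        = (N : PowerSeries R) := by
  let _ : Fintype ↥(NSet p a) := Set.Finite.fintype ha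
  let _ : DecidableEq ↥(NSet p a) := Classical.decEq _
  have hdet : (adjDet p a ha).map (Int.castRingHom R) =
      (1 - Matrix.of (fun u v : ↥(NSet p a) => Polynomial.C (((Finset.univ.filter
        (fun i : Fin p => subSeq p (u : ℕ → R) 1 (i : ℕ) = (v : ℕ → R))).card : R))
        * Polynomial.X)).det := by
    rw [adjDet, ← Polynomial.coe_mapRingHom, RingHom.map_det, map_sub, map_one]
    congr 2
    ext u v : 2
    simp
  rw [hdet]
  refine exists_det_mul_eq Polynomial.coeToPowerSeries.ringHom _
    (fun u : ↥(NSet p a) => LxSeries p (u : ℕ → R))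
    (fun u => Polynomial.X * Polynomial.C (∑ i ∈ Finset.range (p - 1), (u : ℕ → R) i)) ?_
    ⟨a, self_mem_NSet p a⟩
  funext u
  rw [← RingHom.mapMatrix_apply, map_sub, map_one, Matrix.sub_mulVec, Matrix.one_mulVec,
    Pi.sub_apply]
  have hsum : ∑ i ∈ Finset.range p, LxSeries p (subSeq p (u : ℕ → R) 1 i) =
      ∑ v : ↥(NSet p a), ((Finset.univ.filter
        (fun i : Fin p => subSeq p (u : ℕ → R) 1 (i : ℕ) = (v : ℕ → R))).card : PowerSeries R)
        * LxSeries p (v : ℕ → R) := by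
    rw [Finset.sum_range, ← Finset.sum_fiberwise (s := Finset.univ)
      (g := fun i : Fin p => (⟨_, subSeq_one_mem_NSet u.2 i.2⟩ : ↥(NSet p a)))]
    refine Finset.sum_congr rfl fun v _ => ?_
    simp only [Subtype.ext_iff]
    rw [← nsmul_eq_mul]
    refine Finset.sum_eq_card_nsmul fun i hi => ?_
    rw [(Finset.mem_filter.mp hi).2]
  rw [LxSeries_eq hp, hsum]
  simp only [Function.comp_apply, Matrix.mulVec, dotProduct, RingHom.mapMatrix_apply,
    Matrix.map_apply, Matrix.of_apply, map_mul, Polynomial.coeToPowerSeries.ringHom_apply,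
    Polynomial.coe_C, Polynomial.coe_X, map_natCast, Finset.mul_sum]
  rw [add_sub_assoc, add_eq_left, sub_eq_zero]
  exact Finset.sum_congr rfl fun v _ => by ring

/-- (1) For every `u ∈ N(a)`: `L(u,x) = x (u_1 + ⋯ + u_{p-1}) + x ∑_{i<p} L(t_i(u), x)`;
(2) `D(0) = 1` and `D(x) L(a,x)` is a polynomial, so `L(a,x)` is a rational fraction. -/
theorem stmt_16 {p : ℕ} (hp : 2 ≤ p) {R : Type*} [CommRing R] (a : ℕ → R)
    (ha : IsAutomatic p a) :
    (∀ u ∈ NSet p a,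
      LxSeries p u =
        PowerSeries.X * PowerSeries.C (R := R) (∑ i ∈ Finset.range (p - 1), u i) +
        PowerSeries.X * ∑ i ∈ Finset.range p, LxSeries p (subSeq p u 1 i)) ∧
    (adjDet p a ha).eval 0 = 1 ∧
    ∃ N : Polynomial R,
      (((adjDet p a ha).map (Int.castRingHom R) : Polynomial R) : PowerSeries R)
          * LxSeries p a
        = (N : PowerSeries R) := by
  exact ⟨fun u _ => LxSeries_eq hp u, eval_zero_adjDet p a ha,
    exists_polynomial_adjDet_mul_LxSeries hp a ha⟩
end

section
/- Let p ≥ 2 be an integer and let N, D ∈ ℂ[x] with D(0) ≠ 0. Assume every complex root of D has absolute value ≥ 1/p, that every root of D of absolute value exactly 1/p is a simple root, and let α_1, …, α_K be the roots of D of absolute value exactly 1/p. Let Σ_{n≥0} s_n x^n be the power series expansion of N/D (i.e. the unique power series F with D·F = N). Then (Σ_{j=1}^{n} s_j)/p^n − Σ_{k=1}^{K} [ N(α_k) / ( D′(α_k) · (α_k² − α_k) ) ] · (p α_k)^{−n} tends to 0 as n → ∞. (Here 1/D′(α_k) is the residue of 1/D at the simple root α_k, and (pα_k)^{−n} = e^{−niθ_k}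 when α_k = (1/p)e^{iθ_k}.) -/
open Polynomial in
/-- The inverse of `X - β` in the ring of power series over a field is `-∑ X ^ n / β ^ (n + 1)`. -/
theorem Polynomial.X_sub_C_mul_mk_inv {k : Type*} [Field k] {β : k} (hβ : β ≠ 0) :
    ((X - C β : k[X]) : PowerSeries k) * PowerSeries.mk (fun n => -(β⁻¹ ^ (n + 1))) = 1 := by
  rw [Polynomial.coe_sub, Polynomial.coe_X, Polynomial.coe_C, sub_mul]
  ext n
  cases n with
  | zero => simp [hβ]
  | succ n =>
    simp [PowerSeries.coeff_succ_X_mul, PowerSeries.coeff_one, pow_succ]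
    field_simp
    simp

/-- Absolute convergence at `w` is preserved by products of power series. -/
theorem PowerSeries.summable_norm_coeff_mul {𝕜 : Type*} [NormedField 𝕜]
    {F G : PowerSeries 𝕜} {w : 𝕜}
    (hF : Summable fun n => ‖PowerSeries.coeff n F * w ^ n‖)
    (hG : Summable fun n => ‖PowerSeries.coeff n G * w ^ n‖) :
    Summable fun n => ‖PowerSeries.coeff n (F * G) * w ^ n‖ := by
  refine (summable_norm_sum_mul_antidiagonal_of_summable_norm hF hG).congr fun n => ?_
  rw [PowerSeries.coeff_mul, Finset.sum_mul]
  congr 1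
  refine Finset.sum_congr rfl fun x hx => ?_
  rw [← Finset.HasAntidiagonal.mem_antidiagonal.mp hx, pow_add]
  ring

/-- A polynomial converges absolutely everywhere. -/
theorem Polynomial.summable_norm_coeff {𝕜 : Type*} [NormedField 𝕜] (P : Polynomial 𝕜) (w : 𝕜) :
    Summable fun n => ‖PowerSeries.coeff n (P : PowerSeries 𝕜) * w ^ n‖ := by
  have h (n) (hn : n ∉ Finset.range (P.natDegree + 1)) :
      ‖PowerSeries.coeff n (P : PowerSeries 𝕜) * w ^ n‖ = 0 := by
    rw [Polynomial.coeff_coe, Polynomial.coeff_eq_zero_of_natDegree_lt, zero_mul, norm_zero]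
    exact Nat.lt_of_succ_le (by simpa using hn)
  exact summable_of_ne_finset_zero h

open Polynomial in
/-- Dividing by `X - β` preserves absolute convergence at any `w` with `‖w‖ < ‖β‖`. -/
theorem Polynomial.summable_norm_coeff_of_X_sub_C_mul {𝕜 : Type*} [NormedField 𝕜]
    {F : PowerSeries 𝕜} {w β : 𝕜} (hβ : ‖w‖ < ‖β‖)
    (hF : Summable fun n =>
      ‖PowerSeries.coeff n (((X - C β : 𝕜[X]) : PowerSeries 𝕜) * F) * w ^ n‖) :
    Summable fun n => ‖PowerSeries.coeff n F * w ^ n‖ := by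
  have hβ_pos : 0 < ‖β‖ := (norm_nonneg w).trans_lt hβ
  have hβ_ne : β ≠ 0 := norm_pos_iff.mp hβ_pos
  have hinv : Summable fun n =>
      ‖PowerSeries.coeff n (PowerSeries.mk fun n => -(β⁻¹ ^ (n + 1))) * w ^ n‖ := by
    refine ((summable_geometric_of_lt_one (by positivity)
      ((div_lt_one hβ_pos).mpr hβ)).mul_left ‖β‖⁻¹).congr fun n => ?_
    simp only [PowerSeries.coeff_mk, norm_mul, norm_neg, norm_pow, norm_inv]
    rw [div_pow, inv_pow, pow_succ]
    field_simp
  have h := PowerSeries.summable_norm_coeff_mul hinv hF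
  rwa [← mul_assoc, mul_comm (PowerSeries.mk _), Polynomial.X_sub_C_mul_mk_inv hβ_ne,
    one_mul] at h

/-- Dividing by a polynomial preserves absolute convergence at `w` when all its roots have
absolute value greater than `‖w‖`. -/
theorem PowerSeries.summable_norm_coeff_of_polynomial_mul {𝕜 : Type*} [NormedField 𝕜]
    [IsAlgClosed 𝕜] {w : 𝕜} (Q : Polynomial 𝕜) (hQ : ∀ z, Q.eval z = 0 → ‖w‖ < ‖z‖)
    {F : PowerSeries 𝕜}
    (hF : Summable fun n => ‖PowerSeries.coeff n ((Q : PowerSeries 𝕜) * F) * w ^ n‖) :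
    Summable fun n => ‖PowerSeries.coeff n F * w ^ n‖ := by
  induction hd : Q.natDegree generalizing Q with
  | zero =>
    obtain ⟨c, rfl⟩ := Polynomial.natDegree_eq_zero.mp hd
    have hc : c ≠ 0 := by
      rintro rfl
      exact (norm_nonneg w).not_gt (by simpa using hQ 0 (by simp))
    refine (hF.mul_left ‖c‖⁻¹).congr fun n => ?_
    rw [Polynomial.coe_C, PowerSeries.coeff_C_mul, mul_assoc, norm_mul c,
      inv_mul_cancel_left₀ (norm_ne_zero_iff.mpr hc)]
  | succ d ih =>
    obtain ⟨β, hβ⟩ := IsAlgClosed.exists_root Q fun h => by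
      simp [Polynomial.natDegree_eq_of_degree_eq_some h] at hd
    obtain ⟨R, rfl⟩ := Polynomial.dvd_iff_isRoot.mpr hβ
    have hR : R ≠ 0 := by
      rintro rfl
      simp at hd
    rw [Polynomial.natDegree_mul (Polynomial.X_sub_C_ne_zero β) hR,
      Polynomial.natDegree_X_sub_C] at hd
    refine ih R (fun z hz => hQ z (by simp [hz])) ?_ (by omega)
    rw [Polynomial.coe_mul, mul_assoc] at hF
    exact Polynomial.summable_norm_coeff_of_X_sub_C_mul (hQ β hβ) hF

open Polynomial in
/-- A polynomial vanishing at pairwise distinct points is divisible by the product of the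
corresponding linear factors. -/
theorem Polynomial.prod_X_sub_C_dvd_of_injective {ι k : Type*} [Fintype ι] [Field k] {α : ι → k}
    (hα : Function.Injective α) {P : k[X]} (hP : ∀ i, P.eval (α i) = 0) :
    ∏ i, (X - C (α i)) ∣ P :=
  Finset.prod_dvd_of_coprime
    (fun _ _ _ _ hij => Polynomial.pairwise_coprime_X_sub_C hα hij)
    fun i _ => Polynomial.dvd_iff_isRoot.mpr (hP i)

open Polynomial in
/-- Removing the polar parts at the simple roots `α i` of a polynomial `E` from a power series `G`
with `E * G = N` leaves a power series converging absolutely at `w`, provided the other roots of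
`E` have absolute value greater than `‖w‖`. -/
theorem Polynomial.summable_norm_coeff_sub_polar_part {ι 𝕜 : Type*} [Fintype ι] [NormedField 𝕜]
    [IsAlgClosed 𝕜] {w : 𝕜} {N E : 𝕜[X]} {α : ι → 𝕜} (hα : Function.Injective α)
    (hα_ne : ∀ i, α i ≠ 0) (hE : ∀ i, E.eval (α i) = 0)
    (hE' : ∀ i, E.derivative.eval (α i) ≠ 0)
    (hroots : ∀ z, E.eval z = 0 → (∃ i, α i = z) ∨ ‖w‖ < ‖z‖)
    {G : PowerSeries 𝕜} (hG : (E : PowerSeries 𝕜) * G = N) :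
    Summable fun n => ‖(PowerSeries.coeff n G +
      ∑ i, N.eval (α i) / E.derivative.eval (α i) * (α i)⁻¹ ^ (n + 1)) * w ^ n‖ := by
  classical
  choose R hR using fun i => Polynomial.dvd_iff_isRoot.mpr (hE i)
  have hR_self (i) : (R i).eval (α i) = E.derivative.eval (α i) := by
    rw [hR i]
    simp
  have hR_ne (i j) (hij : i ≠ j) : (R i).eval (α j) = 0 := by
    have h := hE j
    rw [hR i, Polynomial.eval_mul] at h
    refine (mul_eq_zero.mp h).resolve_left ?_
    simpa [sub_eq_zero] using fun h => hij (hα h.symm)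
  set c : ι → 𝕜 := fun i => N.eval (α i) / E.derivative.eval (α i) with hc
  obtain ⟨Q, hQ⟩ := Polynomial.prod_X_sub_C_dvd_of_injective hα hE
  obtain ⟨P, hP⟩ := Polynomial.prod_X_sub_C_dvd_of_injective hα
    (P := N - ∑ i, C (c i) * R i) fun j => by
      rw [Polynomial.eval_sub, Polynomial.eval_finsetSum, Finset.sum_eq_single j]
      · simp [hR_self, hc, hE' j]
      · intro i _ hij
        simp [hR_ne i j hij]
      · simp
  set A : 𝕜[X] := ∏ i, (X - C (α i)) with hA
  have hA_ne : A ≠ 0 := (Polynomial.monic_prod_X_sub_C α Finset.univ).ne_zero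
  have hQ_roots (z) (hz : Q.eval z = 0) : ‖w‖ < ‖z‖ := by
    refine (hroots z (by simp [hQ, hz])).resolve_left ?_
    rintro ⟨i, rfl⟩
    have hA_root : A.eval (α i) = 0 := by
      rw [hA, Polynomial.eval_prod]
      exact Finset.prod_eq_zero (Finset.mem_univ i) (by simp)
    exact hE' i (by simp [hQ, hz, hA_root])
  let inv (i : ι) : PowerSeries 𝕜 := PowerSeries.mk fun n => -((α i)⁻¹ ^ (n + 1))
  set H : PowerSeries 𝕜 := G - ∑ i, PowerSeries.C (c i) * inv i with hH
  have hE_inv (i) : (E : PowerSeries 𝕜) * inv i = R i := by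
    conv_lhs => rw [hR i]
    rw [Polynomial.coe_mul, mul_right_comm, Polynomial.X_sub_C_mul_mk_inv (hα_ne i), one_mul]
  have hcoe : ((N - ∑ i, C (c i) * R i : 𝕜[X]) : PowerSeries 𝕜) =
      N - ∑ i, PowerSeries.C (c i) * (R i : PowerSeries 𝕜) := by
    rw [Polynomial.coe_sub]
    congr 1
    rw [← Polynomial.coeToPowerSeries.ringHom_apply, map_sum]
    simp
  have hEH : (E : PowerSeries 𝕜) * H = ((N - ∑ i, C (c i) * R i : 𝕜[X]) : PowerSeries 𝕜) := by
    rw [hcoe, hH, mul_sub, hG, Finset.mul_sum]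
    congr 1
    refine Finset.sum_congr rfl fun i _ => ?_
    rw [mul_left_comm, hE_inv]
  have hQH : (Q : PowerSeries 𝕜) * H = P := by
    rw [hP, hQ, Polynomial.coe_mul, Polynomial.coe_mul, mul_assoc] at hEH
    exact mul_left_cancel₀ (Polynomial.coe_eq_zero_iff.not.mpr hA_ne) hEH
  refine (PowerSeries.summable_norm_coeff_of_polynomial_mul Q hQ_roots
    (hQH ▸ P.summable_norm_coeff w)).congr fun n => ?_
  simp [hH, inv, PowerSeries.coeff_C_mul, hc]

/-- Multiplication by `1 - X` turns the series of partial sums back into the original series. -/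
theorem PowerSeries.one_sub_X_mul_mk_sum_range {R : Type*} [CommRing R] (s : ℕ → R) :
    (1 - PowerSeries.X) * PowerSeries.mk (fun n => ∑ j ∈ Finset.range (n + 1), s j) =
      PowerSeries.mk s := by
  rw [sub_mul, one_mul]
  ext n
  cases n with
  | zero => simp
  | succ n => simp [PowerSeries.coeff_succ_X_mul, Finset.sum_range_succ _ (n + 1)]


/-- Asymptotics of partial sums of the coefficients of a rational function `N/D`: if all roots
of `D` have absolute value `≥ 1/p` and the roots `α_1, …, α_K` of absolute value exactly `1/p`
are simple, then `(∑_{j=1}^n s_j)/p^n = ∑_k N(α_k) Res(1/D, α_k)/(α_k² - α_k) · (p α_k)^{-n}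
+ o(1)`, where `Res(1/D, α_k) = 1/D'(α_k)`. -/
theorem stmt_17 {p : ℕ} (hp : 2 ≤ p) (N D : Polynomial ℂ) (hD0 : D.eval 0 ≠ 0)
    (hroots : ∀ z : ℂ, D.eval z = 0 → (1 : ℝ) / p ≤ ‖z‖)
    (hsimple : ∀ z : ℂ, D.eval z = 0 → ‖z‖ = 1 / p → D.derivative.eval z ≠ 0)
    (K : ℕ) (α : Fin K → ℂ) (hinj : Function.Injective α)
    (hα : ∀ z : ℂ, (D.eval z = 0 ∧ ‖z‖ = 1 / p) ↔ ∃ k, α k = z)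
    (s : ℕ → ℂ) (hs : (D : PowerSeries ℂ) * PowerSeries.mk s = (N : PowerSeries ℂ)) :
    Filter.Tendsto (fun n : ℕ =>
        (∑ j ∈ Finset.Icc 1 n, s j) / (p : ℂ) ^ n -
          ∑ k : Fin K,
            N.eval (α k) / (D.derivative.eval (α k) * ((α k) ^ 2 - α k))
              * ((p : ℂ) * α k)⁻¹ ^ n)
      Filter.atTop (nhds 0) := by
  have hp_pos : (0 : ℝ) < p := by positivity
  have hα_root (k) : D.eval (α k) = 0 ∧ ‖α k‖ = 1 / p := (hα _).mpr ⟨k, rfl⟩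
  have hp_lt : (1 : ℝ) / p < 1 := by
    rw [div_lt_one hp_pos]
    exact_mod_cast hp
  have hw : ‖(p : ℂ)⁻¹‖ = 1 / p := by simp
  have hα_ne (k) : α k ≠ 0 := by
    intro h
    exact hD0 (h ▸ (hα_root k).1)
  have hα_one (k) : 1 - α k ≠ 0 := by
    intro h
    have h_norm := (hα_root k).2
    rw [← sub_eq_zero.mp h, norm_one] at h_norm
    exact hp_lt.ne' h_norm
  have hderiv (k) : (D * (1 - Polynomial.X)).derivative.eval (α k) =
      D.derivative.eval (α k) * (1 - α k) := by
    simp [Polynomial.derivative_mul, (hα_root k).1]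
  have hsum := Polynomial.summable_norm_coeff_sub_polar_part (w := (p : ℂ)⁻¹) (N := N)
    (E := D * (1 - Polynomial.X)) hinj hα_ne (fun k => by simp [(hα_root k).1])
    (fun k => by
      rw [hderiv]
      exact mul_ne_zero (hsimple _ (hα_root k).1 (hα_root k).2) (hα_one k))
    (fun z hz => by
      rw [hw]
      rw [Polynomial.eval_mul, mul_eq_zero] at hz
      rcases hz with hz | hz
      · rcases (hroots z hz).eq_or_lt with h | h
        · exact Or.inl ((hα z).mp ⟨hz, h.symm⟩)
        · exact Or.inr h
      · have hz_one : z = 1 := by simpa [sub_eq_zero, eq_comm (a := (1 : ℂ))] using hz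
        exact Or.inr (by simpa [hz_one] using hp_lt))
    (G := PowerSeries.mk fun n => ∑ j ∈ Finset.range (n + 1), s j)
    (by
      rw [Polynomial.coe_mul, Polynomial.coe_sub, Polynomial.coe_one, Polynomial.coe_X,
        mul_assoc, PowerSeries.one_sub_X_mul_mk_sum_range, hs])
  have hlim := tendsto_zero_iff_norm_tendsto_zero.mpr hsum.tendsto_atTop_zero
  have hconst : Filter.Tendsto (fun n : ℕ => s 0 * (p : ℂ)⁻¹ ^ n) Filter.atTop (nhds 0) := by
    simpa only [mul_zero] using
      (tendsto_pow_atTop_nhds_zero_of_norm_lt_one (hw ▸ hp_lt)).const_mul (s 0)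
  have hdiff := hlim.sub hconst
  rw [sub_zero] at hdiff
  refine hdiff.congr fun n => ?_
  have hIcc : ∑ j ∈ Finset.range (n + 1), s j = ∑ j ∈ Finset.Icc 1 n, s j + s 0 := by
    rw [Finset.range_eq_Ico, Finset.sum_eq_sum_Ico_succ_bot n.succ_pos, add_comm]
    rfl
  rw [PowerSeries.coeff_mk, hIcc, add_mul, Finset.sum_mul]
  have hterm (k) : N.eval (α k) / (D * (1 - Polynomial.X)).derivative.eval (α k) *
      (α k)⁻¹ ^ (n + 1) * (p : ℂ)⁻¹ ^ n =
      -(N.eval (α k) / (D.derivative.eval (α k) * ((α k) ^ 2 - α k)) *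
        ((p : ℂ) * α k)⁻¹ ^ n) := by
    have hD' := hsimple _ (hα_root k).1 (hα_root k).2
    rw [hderiv, show (α k) ^ 2 - α k = -(α k * (1 - α k)) by ring, mul_inv, mul_pow, pow_succ]
    field_simp [hα_one k, hα_ne k]
  rw [Finset.sum_congr rfl fun k _ => hterm k, Finset.sum_neg_distrib, inv_pow]
  ring
end

section
/- Let p ≥ 2 and let a be a p-automatic sequence on the finite alphabet {d_1, …, d_r}. For each i and each n ≥ 1, let c_{i,n} = #{ m : p^{n−1} ≤ m < p^n, a_m = d_i } (the number of integers of base-p length n at which a takes the value d_i), and let F_i = Σ_{n≥1} c_{i,n} x^n ∈ ℚ[[x]]. Suppose P_1, …, P_r, D ∈ ℤ[x] satisfy D(0) ≠ 0 and D · F_i = P_i in ℚ[[x]] for each i. Assume every complex root of D has absolute value ≥ 1/p and every root of absolute value exactly 1/p is simple, and let α_1, …, α_K be the roots of D of absolute value exactly 1/p. Then for each i, a[p^n, d_i]/p^n − Σ_{k=1}^{K} [ P_i(α_k) / ( D′(α_k) · (α_k² − α_k) ) ] · (p α_k)^{−n} tends to 0 as n → ∞. -/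
open scoped Classical

/-- `a[p^n, d_i]`: the number of indices `1 ≤ m ≤ p^n` with `a_m = i`. -/
def letterCount (p : ℕ) {r : ℕ} (a : ℕ → Fin r) (i : Fin r) (n : ℕ) : ℕ :=
  ((Finset.range (p ^ n)).filter (fun m => a m = i)).card

/-- `c_{i,n}`: the number of integers `m` with `p^(n-1) ≤ m < p^n` (i.e. of base-`p` length
`n`) such that `a_m = d_i`. -/
def letterCountLen (p : ℕ) {r : ℕ} (a : ℕ → Fin r) (i : Fin r) (n : ℕ) : ℕ :=
  ((Finset.Ico (p ^ (n - 1)) (p ^ n)).filter (fun m => a (m - 1) = i)).card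

open Polynomial in
/-- A power series whose product with `X - β`, `ρ < ‖β‖`, converges absolutely at radius `ρ`
converges absolutely at radius `ρ`. -/
lemma summable_of_X_sub_C_mul {ρ : ℝ} (hρ : 0 < ρ) {β : ℂ} (hβ : ρ < ‖β‖) {H : PowerSeries ℂ}
    (h : Summable fun n => ‖PowerSeries.coeff n (((X - C β : ℂ[X]) : PowerSeries ℂ) * H)‖ * ρ ^ n) :
    Summable fun n => ‖PowerSeries.coeff n H‖ * ρ ^ n := by
  have hβ0 : β ≠ 0 := norm_pos_iff.mp (hρ.trans hβ)
  set L := ((X - C β : ℂ[X]) : PowerSeries ℂ) * H with hL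
  have hgeo : Summable fun n : ℕ => ‖β⁻¹ ^ n‖ * ρ ^ n := by
    have : Summable fun n : ℕ => (ρ / ‖β‖) ^ n :=
      summable_geometric_of_lt_one (by positivity) ((div_lt_one (hρ.trans hβ)).mpr hβ)
    refine this.congr fun n => ?_
    rw [norm_pow, norm_inv, ← mul_pow, div_eq_inv_mul]
  have hinv : H = PowerSeries.C (-β⁻¹) * (PowerSeries.mk (fun n => β⁻¹ ^ n) * L) := by
    have hone : PowerSeries.C (-β⁻¹) *
        (PowerSeries.mk (fun n => β⁻¹ ^ n) * ((X - C β : ℂ[X]) : PowerSeries ℂ)) = 1 := by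
      ext n
      rw [PowerSeries.coeff_C_mul]
      cases n with
      | zero => simp [mul_sub, hβ0]
      | succ n =>
        simp [mul_sub, PowerSeries.coeff_succ_mul_X, PowerSeries.coeff_one, pow_succ]
        field_simp
        ring
    rw [hL, ← mul_assoc (PowerSeries.mk _), ← mul_assoc, hone, one_mul]
  have hconv := summable_norm_sum_mul_antidiagonal_of_summable_norm
    (f := fun n : ℕ => β⁻¹ ^ n * (ρ : ℂ) ^ n)
    (g := fun n : ℕ => PowerSeries.coeff n L * (ρ : ℂ) ^ n)
    (hgeo.congr fun n => by simp [abs_of_pos hρ]) (h.congr fun n => by simp [abs_of_pos hρ])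
  refine (hconv.mul_left ‖-β⁻¹‖).congr fun n => ?_
  conv_rhs => rw [hinv]
  rw [PowerSeries.coeff_C_mul, norm_mul, PowerSeries.coeff_mul, mul_assoc]
  congr 1
  have : ρ ^ n = ‖(ρ : ℂ) ^ n‖ := by simp [abs_of_pos hρ]
  rw [this, ← norm_mul, Finset.sum_mul]
  congr 1
  refine Finset.sum_congr rfl fun x hx => ?_
  rw [← Finset.HasAntidiagonal.mem_antidiagonal.mp hx, PowerSeries.coeff_mk, pow_add]
  ring

open Polynomial in
/-- A rational power series all of whose poles have modulus larger than `ρ` converges absolutely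
at radius `ρ`. -/
lemma summable_of_mul_eq_polynomial {ρ : ℝ} (hρ : 0 < ρ) {E N : ℂ[X]}
    (hE : ∀ z, E.eval z = 0 → ρ < ‖z‖) {H : PowerSeries ℂ}
    (hEH : (E : PowerSeries ℂ) * H = (N : PowerSeries ℂ)) :
    Summable fun n => ‖PowerSeries.coeff n H‖ * ρ ^ n := by
  have hE0 : E ≠ 0 := by
    rintro rfl
    have := hE 0 (by simp)
    rw [norm_zero] at this
    exact absurd this hρ.not_gt
  have key : ∀ s : Multiset ℂ, (∀ z ∈ s, ρ < ‖z‖) → ∀ H : PowerSeries ℂ,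
      (Summable fun n => ‖PowerSeries.coeff n
        (((s.map fun z => X - C z).prod : ℂ[X]) * H : PowerSeries ℂ)‖ * ρ ^ n) →
      Summable fun n => ‖PowerSeries.coeff n H‖ * ρ ^ n := by
    intro s
    induction s using Multiset.induction_on with
    | empty => intro _ H h; simpa using h
    | cons β s ih =>
      intro hs H h
      refine summable_of_X_sub_C_mul hρ (hs β (Multiset.mem_cons_self β s))
        (ih (fun z hz => hs z (Multiset.mem_cons_of_mem hz)) _ ?_)
      rw [Multiset.map_cons, Multiset.prod_cons, Polynomial.coe_mul] at h
      rwa [← mul_assoc, mul_comm (((s.map fun z => X - C z).prod : ℂ[X]) : PowerSeries ℂ)]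
  refine key E.roots (fun z hz => hE z ((mem_roots hE0).mp hz)) H ?_
  have hsplit := (IsAlgClosed.splits E).eq_prod_roots
  have hlead : E.leadingCoeff ≠ 0 := leadingCoeff_ne_zero.mpr hE0
  have hprod : (((E.roots.map fun z => X - C z).prod : ℂ[X]) : PowerSeries ℂ) * H
      = ((C E.leadingCoeff⁻¹ * N : ℂ[X]) : PowerSeries ℂ) := by
    rw [Polynomial.coe_mul, ← hEH, ← mul_assoc, ← Polynomial.coe_mul]
    congr 2
    conv_rhs => rhs; rw [hsplit]
    rw [← mul_assoc, ← C_mul, inv_mul_cancel₀ hlead, C_1, one_mul]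
  rw [hprod]
  refine summable_of_ne_finset_zero (s := (C E.leadingCoeff⁻¹ * N).support) fun n hn => ?_
  rw [Polynomial.coeff_coe, notMem_support_iff.mp hn, norm_zero, zero_mul]

open Polynomial in
/-- Coefficient asymptotics of a rational power series whose poles of minimal modulus are simple. -/
lemma tendsto_coeff_of_simple_poles {ρ : ℝ} (hρ : 0 < ρ) {D P : ℂ[X]} {G : PowerSeries ℂ}
    (hDG : (D : PowerSeries ℂ) * G = (P : PowerSeries ℂ))
    (hroots : ∀ z, D.eval z = 0 → ρ ≤ ‖z‖)
    (hsimple : ∀ z, D.eval z = 0 → ‖z‖ = ρ → D.derivative.eval z ≠ 0)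
    {ι : Type*} [Fintype ι] {α : ι → ℂ} (hinj : Function.Injective α)
    (hα : ∀ z, (D.eval z = 0 ∧ ‖z‖ = ρ) ↔ ∃ k, α k = z) :
    Filter.Tendsto (fun n : ℕ => (PowerSeries.coeff n G +
      ∑ k, P.eval (α k) / (D.derivative.eval (α k) * α k) * (α k)⁻¹ ^ n) * (ρ : ℂ) ^ n)
      Filter.atTop (nhds 0) := by
  have hroot k : D.eval (α k) = 0 := ((hα _).mpr ⟨k, rfl⟩).1
  have hnorm k : ‖α k‖ = ρ := ((hα _).mpr ⟨k, rfl⟩).2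
  have hα0 k : α k ≠ 0 := norm_pos_iff.mp (by rw [hnorm]; exact hρ)
  have hder k := hsimple _ (hroot k) (hnorm k)
  choose q hq using fun k => dvd_iff_isRoot.mpr (hroot k)
  have hq_self k : (q k).eval (α k) = D.derivative.eval (α k) := by
    conv_rhs => rw [hq k]
    simp
  have hq_ne {j k} (hjk : k ≠ j) : (q k).eval (α j) = 0 := by
    have h := hroot j
    rw [hq k, eval_mul] at h
    refine (mul_eq_zero.mp h).resolve_left ?_
    simpa [sub_eq_zero] using fun h => hjk (hinj h).symm
  set c : ι → ℂ := fun k => P.eval (α k) / (D.derivative.eval (α k) * α k) with hc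
  set M : ℂ[X] := ∏ k, (X - C (α k)) with hM
  have hM0 : M ≠ 0 := Finset.prod_ne_zero_iff.mpr fun k _ => X_sub_C_ne_zero _
  have hM_dvd {N : ℂ[X]} (hN : ∀ k, N.eval (α k) = 0) : M ∣ N :=
    Finset.prod_dvd_of_coprime
      (fun j _ k _ hjk => pairwise_coprime_X_sub_C hinj hjk)
      fun k _ => dvd_iff_isRoot.mpr (hN k)
  set N : ℂ[X] := P - ∑ k, C (c k * α k) * q k with hN
  have hNroot j : N.eval (α j) = 0 := by
    rw [hN, eval_sub, eval_finsetSum, Finset.sum_eq_single j, eval_mul, eval_C, hq_self, hc]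
    · have := hder j
      have := hα0 j
      field_simp
      ring
    · intro k _ hk
      rw [eval_mul, hq_ne hk, mul_zero]
    · simp
  obtain ⟨E, hE⟩ := hM_dvd hroot
  obtain ⟨N', hN'⟩ := hM_dvd hNroot
  set H : PowerSeries ℂ :=
    G + ∑ k, PowerSeries.C (c k) * PowerSeries.mk (fun n => (α k)⁻¹ ^ n) with hH
  have hgeo k : ((X - C (α k) : ℂ[X]) : PowerSeries ℂ) * PowerSeries.mk (fun n => (α k)⁻¹ ^ n)
      = ((C (-α k) : ℂ[X]) : PowerSeries ℂ) := by
    ext n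
    cases n with
    | zero => simp [sub_mul]
    | succ n =>
      simp [sub_mul, PowerSeries.coeff_succ_X_mul, pow_succ, hα0, mul_comm]
  have hDH : (D : PowerSeries ℂ) * H = (N : PowerSeries ℂ) := by
    rw [hH, mul_add, hDG, Finset.mul_sum, hN, sub_eq_add_neg, ← Finset.sum_neg_distrib,
      Polynomial.coe_add]
    congr 1
    rw [← Polynomial.coeToPowerSeries.ringHom_apply (φ := ∑ k, _), map_sum]
    refine Finset.sum_congr rfl fun k _ => ?_
    rw [Polynomial.coeToPowerSeries.ringHom_apply]
    have : (-(C (c k * α k) * q k) : ℂ[X]) = C (c k) * C (-α k) * q k := by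
      simp [C_mul]
    rw [this, Polynomial.coe_mul, Polynomial.coe_mul, ← hgeo]
    conv_lhs => rw [hq k]
    rw [Polynomial.coe_mul, Polynomial.coe_C]
    ring
  have hEH : (E : PowerSeries ℂ) * H = (N' : PowerSeries ℂ) := by
    have hM0' : (M : PowerSeries ℂ) ≠ 0 := by simpa using hM0
    refine mul_left_cancel₀ hM0' ?_
    rw [← mul_assoc, ← Polynomial.coe_mul, ← Polynomial.coe_mul, ← hE, ← hN', hDH]
  have hEroot z (hz : E.eval z = 0) : ρ < ‖z‖ := by
    have hDz : D.eval z = 0 := by rw [hE, eval_mul, hz, mul_zero]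
    refine (hroots z hDz).lt_of_ne fun heq => hsimple z hDz heq.symm ?_
    obtain ⟨k, rfl⟩ := (hα z).mp ⟨hDz, heq.symm⟩
    have hMz : M.eval (α k) = 0 := by
      rw [hM, eval_prod]
      exact Finset.prod_eq_zero (Finset.mem_univ k) (by simp)
    rw [hE, derivative_mul, eval_add, eval_mul, eval_mul, hz, hMz, mul_zero, zero_mul, add_zero]
  have hlim := (summable_of_mul_eq_polynomial hρ hEroot hEH).tendsto_atTop_zero
  rw [tendsto_zero_iff_norm_tendsto_zero]
  refine hlim.congr fun n => ?_
  rw [norm_mul, norm_pow, Complex.norm_real, Real.norm_of_nonneg hρ.le, hH, map_add, map_sum]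
  simp [PowerSeries.coeff_C_mul, hc]

/-- The integers of base-`p` length at most `n` are those in `[1, p ^ n)`; the count up to `p ^ n`
has one further index. -/
lemma letterCount_eq_sum_letterCountLen_add {p : ℕ} (hp : 2 ≤ p) {r : ℕ} (a : ℕ → Fin r)
    (i : Fin r) (n : ℕ) :
    letterCount p a i n = ∑ m ∈ Finset.range (n + 1), letterCountLen p a i m +
      if a (p ^ n - 1) = i then 1 else 0 := by
  have hpos k : 0 < p ^ k := pow_pos (by omega) k
  have hlen n : ∑ m ∈ Finset.range (n + 1), letterCountLen p a i m =
      ((Finset.range (p ^ n - 1)).filter fun m => a m = i).card := by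
    induction n with
    | zero => simp [letterCountLen]
    | succ n ih =>
      have hle : p ^ n ≤ p ^ (n + 1) := Nat.pow_le_pow_right (by omega) n.le_succ
      rw [Finset.sum_range_succ, ih]
      simp only [letterCountLen, Finset.card_filter, Nat.add_sub_cancel]
      rw [← Finset.sum_range_add_sum_Ico _ (Nat.sub_le_sub_right hle 1)]
      congr 1
      have hn := Nat.sub_add_cancel (hpos n)
      have hn' := Nat.sub_add_cancel (hpos (n + 1))
      conv_lhs => rw [← hn, ← hn']
      rw [← Finset.sum_Ico_add']
      simp
  rw [hlen, letterCount, Finset.card_filter, Finset.card_filter, ← Finset.sum_range_succ,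
    Nat.sub_add_cancel (hpos n)]

/-- Asymptotics of letter frequencies along powers of `p`: with `F_i = ∑_n c_{i,n} x^n` and
`D · F_i = P_i`, if all complex roots of `D` have absolute value `≥ 1/p` and the roots
`α_1, …, α_K` of absolute value exactly `1/p` are simple, then `a[p^n, d_i]/p^n =
∑_k P_i(α_k) Res(1/D, α_k)/(α_k² - α_k) · (p α_k)^{-n} + o(1)`. -/
theorem stmt_18 {p : ℕ} (hp : 2 ≤ p) {r : ℕ} (a : ℕ → Fin r) (ha : IsAutomatic p a)
    (P : Fin r → Polynomial ℤ) (D : Polynomial ℤ) (hD0 : D.eval 0 ≠ 0)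
    (hPD : ∀ i : Fin r,
      ((D.map (Int.castRingHom ℚ) : Polynomial ℚ) : PowerSeries ℚ) *
          PowerSeries.mk (fun n => (letterCountLen p a i n : ℚ))
        = (((P i).map (Int.castRingHom ℚ) : Polynomial ℚ) : PowerSeries ℚ))
    (hroots : ∀ z : ℂ, (D.map (Int.castRingHom ℂ)).eval z = 0 →
      (1 : ℝ) / p ≤ ‖z‖)
    (hsimple : ∀ z : ℂ, (D.map (Int.castRingHom ℂ)).eval z = 0 → ‖z‖ = 1 / p →
      (D.map (Int.castRingHom ℂ)).derivative.eval z ≠ 0)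
    (K : ℕ) (α : Fin K → ℂ) (hinj : Function.Injective α)
    (hα : ∀ z : ℂ, ((D.map (Int.castRingHom ℂ)).eval z = 0 ∧ ‖z‖ = 1 / p) ↔
      ∃ k, α k = z) :
    ∀ i : Fin r,
      Filter.Tendsto (fun n : ℕ =>
          (letterCount p a i n : ℂ) / (p : ℂ) ^ n -
            ∑ k : Fin K,
              ((P i).map (Int.castRingHom ℂ)).eval (α k) /
                  ((D.map (Int.castRingHom ℂ)).derivative.eval (α k) * ((α k) ^ 2 - α k))
                * ((p : ℂ) * α k)⁻¹ ^ n)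
        Filter.atTop (nhds 0) := by
  intro i
  have hp0 : (0 : ℝ) < p := by positivity
  have hp1 : (1 : ℝ) / p < 1 := by
    rw [div_lt_one hp0]
    exact_mod_cast hp
  set Dc := D.map (Int.castRingHom ℂ) with hDc
  set Pc := (P i).map (Int.castRingHom ℂ) with hPc
  set F : PowerSeries ℂ := PowerSeries.mk fun n => (letterCountLen p a i n : ℂ) with hF
  have hDF : (Dc : PowerSeries ℂ) * F = (Pc : PowerSeries ℂ) := by
    have h := congrArg (PowerSeries.map (algebraMap ℚ ℂ)) (hPD i)
    rw [map_mul, ← Polynomial.polynomial_map_coe, ← Polynomial.polynomial_map_coe,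
      Polynomial.map_map, Polynomial.map_map] at h
    have hcomp : (algebraMap ℚ ℂ).comp (Int.castRingHom ℚ) = Int.castRingHom ℂ :=
      RingHom.ext_int _ _
    rw [hcomp] at h
    rw [hF, hDc, hPc, ← h]
    congr 1
  set G : PowerSeries ℂ := PowerSeries.mk fun n =>
    ∑ m ∈ Finset.range (n + 1), (letterCountLen p a i m : ℂ) with hG
  have hGF : ((1 - Polynomial.X : Polynomial ℂ) : PowerSeries ℂ) * G = F := by
    ext n
    cases n with
    | zero => simp [sub_mul, hG, hF]
    | succ n =>
      simp [sub_mul, PowerSeries.coeff_succ_X_mul, hG, hF, Finset.sum_range_succ _ (n + 1)]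
  have heval z : (Dc * (1 - Polynomial.X)).eval z = Dc.eval z * (1 - z) := by simp
  have hderiv z (hz : Dc.eval z = 0) :
      (Dc * (1 - Polynomial.X)).derivative.eval z = Dc.derivative.eval z * (1 - z) := by simp [hz]
  have hne (z : ℂ) (hz : ‖z‖ = 1 / p) : 1 - z ≠ 0 := by
    intro h
    rw [← sub_eq_zero.mp h, norm_one] at hz
    exact hp1.ne hz.symm
  have hα' z : ((Dc * (1 - Polynomial.X)).eval z = 0 ∧ ‖z‖ = 1 / p) ↔ ∃ k, α k = z := by
    rw [← hα z, heval]
    refine and_congr_left fun hz => ?_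
    rw [mul_eq_zero, or_iff_left (hne z hz)]
  have hmain := tendsto_coeff_of_simple_poles (ρ := 1 / p) (by positivity)
    (D := Dc * (1 - Polynomial.X)) (P := Pc) (G := G) (by rw [Polynomial.coe_mul, mul_assoc, hGF, hDF])
    (fun z hz => by
      rw [heval] at hz
      rcases mul_eq_zero.mp hz with h | h
      · exact hroots z h
      · rw [← sub_eq_zero.mp h, norm_one]
        exact hp1.le)
    (fun z hz hzn => by
      have hDz : Dc.eval z = 0 := (mul_eq_zero.mp (heval z ▸ hz)).resolve_right (hne z hzn)
      rw [hderiv z hDz]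
      exact mul_ne_zero (hsimple z hDz hzn) (hne z hzn))
    hinj hα'
  have hlast : Filter.Tendsto
      (fun n : ℕ => (if a (p ^ n - 1) = i then (1 : ℂ) else 0) * ((1 / p : ℝ) : ℂ) ^ n)
      Filter.atTop (nhds 0) := by
    refine squeeze_zero_norm (a := fun n : ℕ => ((1 : ℝ) / p) ^ n) (fun n => ?_)
      (tendsto_pow_atTop_nhds_zero_of_lt_one (by positivity) hp1)
    rw [norm_mul, norm_pow, Complex.norm_real, Real.norm_of_nonneg (by positivity)]
    refine mul_le_of_le_one_left (by positivity) ?_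
    split_ifs <;> simp
  have hsum := hmain.add hlast
  rw [add_zero] at hsum
  refine hsum.congr fun n => ?_
  rw [letterCount_eq_sum_letterCountLen_add hp, hG, PowerSeries.coeff_mk, add_mul,
    Finset.sum_mul Finset.univ]
  have hterm : ∀ k : Fin K,
      Pc.eval (α k) / ((Dc * (1 - Polynomial.X)).derivative.eval (α k) * α k) * (α k)⁻¹ ^ n
        * ((1 / p : ℝ) : ℂ) ^ n
      = -(Pc.eval (α k) / (Dc.derivative.eval (α k) * ((α k) ^ 2 - α k))
        * ((p : ℂ) * α k)⁻¹ ^ n) := by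
    intro k
    rw [hderiv _ ((hα _).mpr ⟨k, rfl⟩).1,
      show Dc.derivative.eval (α k) * (1 - α k) * α k
        = -(Dc.derivative.eval (α k) * ((α k) ^ 2 - α k)) by ring, div_neg, mul_inv, mul_pow]
    push_cast
    rw [one_div]
    ring
  rw [Finset.sum_congr rfl fun k _ => hterm k, Finset.sum_neg_distrib]
  push_cast
  rw [one_div, inv_pow, div_eq_mul_inv]
  ring
end
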